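/- arXiv:1102.1274 — 2 statements merged into one kernel-verified Lean document; each statement's English description precedes it below -/
import Mathlib

section
/- Let c, k, n, n₁, n₂ be real constants and define μ : ℝ³ → ℝ³ by μ₁(γ) = c(−nγ₁ − n₁γ₁² + 2n₁γ₂² + n₁γ₃² − 3n₂γ₁γ₂), μ₂(γ) = c(−nγ₂ + 2n₂γ₁² − n₂γ₂² + n₂γ₃² − 3n₁γ₁γ₂), μ₃(γ) = c(k − 3nγ₃ − 5n₁γ₁γ₃ − 5n₂γ₂γ₃). Then μ(γ) = ψ(γ)γ + ∇_γφ(γ) with φ(γ) = c[ kγ₃ + (n + n₁γ₁ + n₂γ₂)(2γ₁² + 2γ₂² + γ₃²) ] and ψ(γ) = −c(5n + 7n₁γ₁ + 7n₂γ₂), and consequently the function C(M,γ) = M·γ + c[ kγ₃ + (n + n₁γ₁ + n₂γ₂)(2γ₁² + 2γ₂² + γ₃²) ] is a Casimir of Π_μ, i.e. Π_μ(M,γ)∇C(M,γ) = 0 for all (M,γ) ∈ ℝ³×ℝ³. -/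
open Matrix

noncomputable section

/-- ℝ³ as triples of reals. -/
abbrev V3 : Type := Fin 3 → ℝ

/-- The cross product on ℝ³. -/
def cross3 (a b : V3) : V3 :=
  ![a 1 * b 2 - a 2 * b 1, a 2 * b 0 - a 0 * b 2, a 0 * b 1 - a 1 * b 0]

/-- The hat map: `hat v` is the skew 3×3 matrix with `hat v * u = v × u`. -/
def hat (v : V3) : Matrix (Fin 3) (Fin 3) ℝ :=
  !![0, -(v 2), v 1; v 2, 0, -(v 0); -(v 1), v 0, 0]

/-- The matrix field Π_μ on ℝ⁶ = ℝ³ × ℝ³, in block form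
`[[hat (M + μ(M,γ)), hat γ], [hat γ, 0]]`. -/
def Pim (μ : V3 × V3 → V3) (p : V3 × V3) :
    Matrix (Fin 3 ⊕ Fin 3) (Fin 3 ⊕ Fin 3) ℝ :=
  Matrix.fromBlocks (hat (p.1 + μ p)) (hat p.2) (hat p.2) 0

/-- The coordinate directions of ℝ⁶ = ℝ³ × ℝ³ (coordinates `(M₁,M₂,M₃,γ₁,γ₂,γ₃)`). -/
def dir : Fin 3 ⊕ Fin 3 → V3 × V3
  | Sum.inl i => (Pi.single i 1, 0)
  | Sum.inr i => (0, Pi.single i 1)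

/-- Π_μ satisfies the Jacobi identity:
`Σ_l (Π^{li} ∂_l Π^{jk} + Π^{lj} ∂_l Π^{ki} + Π^{lk} ∂_l Π^{ij}) = 0` at every point. -/
def JacobiIdentity (μ : V3 × V3 → V3) : Prop :=
  ∀ p : V3 × V3, ∀ i j k : Fin 3 ⊕ Fin 3,
    ∑ l : Fin 3 ⊕ Fin 3,
      (Pim μ p l i * fderiv ℝ (fun q => Pim μ q j k) p (dir l)
        + Pim μ p l j * fderiv ℝ (fun q => Pim μ q k i) p (dir l)
        + Pim μ p l k * fderiv ℝ (fun q => Pim μ q i j) p (dir l)) = 0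

/-- The full gradient ∇C ∈ ℝ⁶ of a function on ℝ³ × ℝ³. -/
def gradFull (C : V3 × V3 → ℝ) (p : V3 × V3) : Fin 3 ⊕ Fin 3 → ℝ :=
  fun l => fderiv ℝ C p (dir l)

/-- `C` is a Casimir of Π_μ : `Π_μ(M,γ) ∇C(M,γ) = 0` everywhere. -/
def IsCasimir (μ : V3 × V3 → V3) (C : V3 × V3 → ℝ) : Prop :=
  ∀ p : V3 × V3, Pim μ p *ᵥ gradFull C p = 0

/-- Gradient in the M-variables (γ fixed) of a function on ℝ³ × ℝ³. -/
def gradM (f : V3 × V3 → ℝ) (p : V3 × V3) : V3 :=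
  fun i => fderiv ℝ f p (Pi.single i 1, 0)

/-- Gradient in the γ-variables (M fixed) of a function on ℝ³ × ℝ³. -/
def gradG (f : V3 × V3 → ℝ) (p : V3 × V3) : V3 :=
  fun i => fderiv ℝ f p (0, Pi.single i 1)

/-- Curl in the M-variables (γ fixed) of a vector field on ℝ³ × ℝ³. -/
def curlM (F : V3 × V3 → V3) (p : V3 × V3) : V3 :=
  ![gradM (fun q => F q 2) p 1 - gradM (fun q => F q 1) p 2,
    gradM (fun q => F q 0) p 2 - gradM (fun q => F q 2) p 0,
    gradM (fun q => F q 1) p 0 - gradM (fun q => F q 0) p 1]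

/-- Curl in the γ-variables (M fixed) of a vector field on ℝ³ × ℝ³. -/
def curlG (F : V3 × V3 → V3) (p : V3 × V3) : V3 :=
  ![gradG (fun q => F q 2) p 1 - gradG (fun q => F q 1) p 2,
    gradG (fun q => F q 0) p 2 - gradG (fun q => F q 2) p 0,
    gradG (fun q => F q 1) p 0 - gradG (fun q => F q 0) p 1]

/-- Gradient of a function on ℝ³. -/
def grad3 (f : V3 → ℝ) (γ : V3) : V3 :=
  fun i => fderiv ℝ f γ (Pi.single i 1)

/-- Curl of a vector field on ℝ³. -/
def curl3 (F : V3 → V3) (γ : V3) : V3 :=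
  ![grad3 (fun x => F x 2) γ 1 - grad3 (fun x => F x 1) γ 2,
    grad3 (fun x => F x 0) γ 2 - grad3 (fun x => F x 2) γ 0,
    grad3 (fun x => F x 1) γ 0 - grad3 (fun x => F x 0) γ 1]

/-- Divergence of a vector field on ℝ³. -/
def div3 (F : V3 → V3) (γ : V3) : ℝ :=
  ∑ i : Fin 3, grad3 (fun x => F x i) γ i

/-- For functions of (γ, s) ∈ ℝ³ × ℝ : gradient in γ at fixed s. -/
def gradg (f : V3 × ℝ → ℝ) (q : V3 × ℝ) : V3 :=
  fun i => fderiv ℝ f q (Pi.single i 1, 0)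

/-- For vector fields of (γ, s) ∈ ℝ³ × ℝ : curl in γ at fixed s. -/
def curlg (F : V3 × ℝ → V3) (q : V3 × ℝ) : V3 :=
  ![gradg (fun x => F x 2) q 1 - gradg (fun x => F x 1) q 2,
    gradg (fun x => F x 0) q 2 - gradg (fun x => F x 2) q 0,
    gradg (fun x => F x 1) q 0 - gradg (fun x => F x 0) q 1]

/-- ∂₄: partial derivative with respect to the fourth variable s, for a vector field ν(γ,s). -/
def d4 (F : V3 × ℝ → V3) (q : V3 × ℝ) : V3 :=
  fun k => fderiv ℝ (fun x => F x k) q (0, 1)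

/-- ∂₄: partial derivative with respect to the fourth variable s, for a scalar function D(γ,s). -/
def d4s (f : V3 × ℝ → ℝ) (q : V3 × ℝ) : ℝ :=
  fderiv ℝ f q (0, 1)

/-- The Kovalevskaya-configuration gyroscopic torque of Yehia (case a). -/
def mu14 (c k n n1 n2 : ℝ) (γ : V3) : V3 :=
  ![c * (-(n * γ 0) - n1 * γ 0 ^ 2 + 2 * n1 * γ 1 ^ 2 + n1 * γ 2 ^ 2 - 3 * n2 * γ 0 * γ 1),
    c * (-(n * γ 1) + 2 * n2 * γ 0 ^ 2 - n2 * γ 1 ^ 2 + n2 * γ 2 ^ 2 - 3 * n1 * γ 0 * γ 1),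
    c * (k - 3 * n * γ 2 - 5 * n1 * γ 0 * γ 2 - 5 * n2 * γ 1 * γ 2)]

def phi14 (c k n n1 n2 : ℝ) (γ : V3) : ℝ :=
  c * (k * γ 2 + (n + n1 * γ 0 + n2 * γ 1) * (2 * γ 0 ^ 2 + 2 * γ 1 ^ 2 + γ 2 ^ 2))

def psi14 (c n n1 n2 : ℝ) (γ : V3) : ℝ :=
  -(c * (5 * n + 7 * n1 * γ 0 + 7 * n2 * γ 1))

theorem hat_mulVec (v u : V3) : hat v *ᵥ u = cross3 v u := by
  ext i
  fin_cases i <;> simp [hat, cross3, Matrix.mulVec, dotProduct, Fin.sum_univ_three] <;> ring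

theorem gradFull_dotProduct_add {φ : V3 → ℝ} (hφ : Differentiable ℝ φ) (p : V3 × V3) :
    gradFull (fun q => q.1 ⬝ᵥ q.2 + φ q.2) p = Sum.elim p.2 (p.1 + grad3 φ p.2) := by
  have h₁ (i : Fin 3) : HasFDerivAt (fun q : V3 × V3 => q.1 i)
      ((ContinuousLinearMap.proj (R := ℝ) i).comp (ContinuousLinearMap.fst ℝ V3 V3)) p :=
    ((ContinuousLinearMap.proj (R := ℝ) i).comp (ContinuousLinearMap.fst ℝ V3 V3)).hasFDerivAt
  have h₂ (i : Fin 3) : HasFDerivAt (fun q : V3 × V3 => q.2 i)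
      ((ContinuousLinearMap.proj (R := ℝ) i).comp (ContinuousLinearMap.snd ℝ V3 V3)) p :=
    ((ContinuousLinearMap.proj (R := ℝ) i).comp (ContinuousLinearMap.snd ℝ V3 V3)).hasFDerivAt
  have hdot := HasFDerivAt.fun_sum (u := Finset.univ) fun i _ => (h₁ i).mul (h₂ i)
  have hC := hdot.add ((hφ p.2).hasFDerivAt.comp p hasFDerivAt_snd)
  have hfderiv := hC.fderiv
  funext l
  refine (DFunLike.congr_fun hfderiv (dir l)).trans ?_
  rcases l with i | i <;> fin_cases i <;>
    simp [dir, grad3, Fin.sum_univ_three]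

theorem isCasimir_of_eq_smul_add_grad3 {μ : V3 → V3} {φ ψ : V3 → ℝ}
    (hφ : Differentiable ℝ φ) (hμ : ∀ γ, μ γ = ψ γ • γ + grad3 φ γ) :
    IsCasimir (fun p => μ p.2) (fun p => p.1 ⬝ᵥ p.2 + φ p.2) := by
  intro p
  rw [gradFull_dotProduct_add hφ, Pim, Matrix.fromBlocks_mulVec]
  simp only [Sum.elim_comp_inl, Sum.elim_comp_inr, hat_mulVec, hμ, Matrix.zero_mulVec, add_zero]
  ext l
  rcases l with i | i <;> fin_cases i <;> simp [cross3] <;> ring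

theorem differentiable_phi14 (c k n n1 n2 : ℝ) : Differentiable ℝ (phi14 c k n n1 n2) := by
  unfold phi14
  fun_prop

theorem grad3_phi14 (c k n n1 n2 : ℝ) (γ : V3) :
    grad3 (phi14 c k n n1 n2) γ =
      ![c * (n1 * (2 * γ 0 ^ 2 + 2 * γ 1 ^ 2 + γ 2 ^ 2) + 4 * γ 0 * (n + n1 * γ 0 + n2 * γ 1)),
        c * (n2 * (2 * γ 0 ^ 2 + 2 * γ 1 ^ 2 + γ 2 ^ 2) + 4 * γ 1 * (n + n1 * γ 0 + n2 * γ 1)),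
        c * (k + 2 * γ 2 * (n + n1 * γ 0 + n2 * γ 1))] := by
  have h (i : Fin 3) : HasFDerivAt (fun x : V3 => x i) (ContinuousLinearMap.proj (R := ℝ) i) γ :=
    hasFDerivAt_apply i γ
  have hφ : HasFDerivAt (phi14 c k n n1 n2) _ γ :=
    (((h 2).const_mul k).add
      (((((h 0).const_mul n1).const_add n).add ((h 1).const_mul n2)).mul
        (((((h 0).pow 2).const_mul 2).add (((h 1).pow 2).const_mul 2)).add
          ((h 2).pow 2)))).const_mul c
  funext i
  rw [grad3, hφ.fderiv]
  fin_cases i <;> simp <;> ring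

/-- μ = ψγ + ∇φ with the indicated φ, ψ, and C(M,γ) = M·γ + φ(γ) is a Casimir of Π_μ. -/
theorem statement14 (c k n n1 n2 : ℝ) :
    (∀ γ : V3, mu14 c k n n1 n2 γ =
      psi14 c n n1 n2 γ • γ + grad3 (phi14 c k n n1 n2) γ) ∧
    IsCasimir (fun p => mu14 c k n n1 n2 p.2)
      (fun p => p.1 ⬝ᵥ p.2 + phi14 c k n n1 n2 p.2) := by
  have hμ : ∀ γ : V3, mu14 c k n n1 n2 γ =
      psi14 c n n1 n2 γ • γ + grad3 (phi14 c k n n1 n2) γ := by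
    intro γ
    rw [grad3_phi14]
    ext i
    fin_cases i <;> simp [mu14, psi14] <;> ring
  exact ⟨hμ, isCasimir_of_eq_smul_add_grad3 (differentiable_phi14 c k n n1 n2) hμ⟩
end
end

section
/- Let μ₃ : ℝ³×ℝ → ℝ be smooth, with arguments (γ,s), and define ν(γ,s) = (0, 0, μ₃(γ,s)). Then ν satisfies the Jacobi condition equation γ · curl_γ ν + ν · ( γ × ∂₄ν ) = 0 for all (γ,s) ∈ ℝ³×ℝ if and only if γ₁ ∂μ₃/∂γ₂ (γ,s) − γ₂ ∂μ₃/∂γ₁ (γ,s) = 0 for all (γ,s) ∈ ℝ³×ℝ; consequently, with μ(M,γ) = (0,0,μ₃(γ, M·γ)), the matrix field Π_μ satisfies the Jacobi identity if and only if this condition holds. -/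
open Matrix

noncomputable section

theorem fderiv_hat_apply {E : Type*} [NormedAddCommGroup E] [NormedSpace ℝ E]
    {f : E → V3} {f' : E →L[ℝ] V3} {p : E} (hf : HasFDerivAt f f' p) (i j : Fin 3) (v : E) :
    fderiv ℝ (fun q => hat (f q) i j) p v = hat (f' v) i j := by
  have hc (k : Fin 3) : HasFDerivAt (fun q => f q k)
      ((ContinuousLinearMap.proj (R := ℝ) (φ := fun _ : Fin 3 => ℝ) k).comp f') p :=
    (hasFDerivAt_pi'.1 hf) k
  fin_cases i <;> fin_cases j <;> simp [hat, (hc _).fderiv]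

/-- The derivative of an entry of `Pim μ` along a direction `v`. -/
theorem fderiv_Pim_apply {μ : V3 × V3 → V3} {μ' : V3 × V3 →L[ℝ] V3} {p : V3 × V3}
    (hμ : HasFDerivAt μ μ' p) (j k : Fin 3 ⊕ Fin 3) (v : V3 × V3) :
    fderiv ℝ (fun q => Pim μ q j k) p v =
      Matrix.fromBlocks (hat (v.1 + μ' v)) (hat v.2) (hat v.2) 0 j k := by
  rcases j with j | j <;> rcases k with k | k
  · exact fderiv_hat_apply (hasFDerivAt_fst.add hμ) j k v
  · exact fderiv_hat_apply hasFDerivAt_snd j k v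
  · exact fderiv_hat_apply hasFDerivAt_snd j k v
  · simp [Pim]

/-- The derivative of `(M, γ) ↦ (γ, M · γ)`. -/
def pairingDeriv (p : V3 × V3) : V3 × V3 →L[ℝ] V3 × ℝ :=
  (ContinuousLinearMap.snd ℝ V3 V3).prod
    (∑ i : Fin 3,
      (p.1 i • (ContinuousLinearMap.proj (R := ℝ) (φ := fun _ : Fin 3 => ℝ) i).comp
          (ContinuousLinearMap.snd ℝ V3 V3)
        + p.2 i • (ContinuousLinearMap.proj (R := ℝ) (φ := fun _ : Fin 3 => ℝ) i).comp
          (ContinuousLinearMap.fst ℝ V3 V3)))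

theorem hasFDerivAt_pairing (p : V3 × V3) :
    HasFDerivAt (fun q : V3 × V3 => (q.2, q.1 ⬝ᵥ q.2)) (pairingDeriv p) p := by
  refine HasFDerivAt.prodMk hasFDerivAt_snd ?_
  refine HasFDerivAt.fun_sum fun i _ => ?_
  exact HasFDerivAt.mul ((hasFDerivAt_pi'.1 hasFDerivAt_fst) i)
    ((hasFDerivAt_pi'.1 hasFDerivAt_snd) i)

theorem pairingDeriv_apply (p v : V3 × V3) :
    pairingDeriv p v = (v.2, p.1 ⬝ᵥ v.2 + p.2 ⬝ᵥ v.1) := by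
  simp [pairingDeriv, dotProduct, Finset.sum_add_distrib]

/-- The embedding of the third axis, `x ↦ (0, 0, x)`. -/
def thirdAxis : ℝ →L[ℝ] V3 :=
  ContinuousLinearMap.toSpanSingleton ℝ ![0, 0, 1]

theorem thirdAxis_apply (x : ℝ) : thirdAxis x = ![0, 0, x] := by
  ext i
  fin_cases i <;> simp [thirdAxis]

theorem fderiv_prodMk_eq (f : V3 × ℝ → ℝ) (q : V3 × ℝ) (γ : V3) (s : ℝ) :
    fderiv ℝ f q (γ, s) = γ ⬝ᵥ gradg f q + s * d4s f q := by
  have hγ : (γ, s) = ∑ i : Fin 3, γ i • ((Pi.single i 1, 0) : V3 × ℝ) + s • (0, 1) := by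
    ext i
    · fin_cases i <;> simp [Fin.sum_univ_three]
    · simp [Fin.sum_univ_three]
  rw [hγ, map_add, map_sum]
  simp only [map_smul, smul_eq_mul, dotProduct, gradg, d4s]

/-- The entries of `Pim μ` for `μ(M,γ) = (0,0,μ₃(γ,M·γ))`, differentiated along `v`. -/
theorem fderiv_Pim_thirdAxis_apply {μ3 : V3 × ℝ → ℝ} (h : Differentiable ℝ μ3)
    (p : V3 × V3) (j k : Fin 3 ⊕ Fin 3) (v : V3 × V3) :
    fderiv ℝ (fun q => Pim (fun p => ![0, 0, μ3 (p.2, p.1 ⬝ᵥ p.2)]) q j k) p v =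
      Matrix.fromBlocks
        (hat (v.1 + ![0, 0, v.2 ⬝ᵥ gradg μ3 (p.2, p.1 ⬝ᵥ p.2) +
          (p.1 ⬝ᵥ v.2 + p.2 ⬝ᵥ v.1) * d4s μ3 (p.2, p.1 ⬝ᵥ p.2)]))
        (hat v.2) (hat v.2) 0 j k := by
  have hμ := thirdAxis.hasFDerivAt.comp p
    ((h (p.2, p.1 ⬝ᵥ p.2)).hasFDerivAt.comp p (hasFDerivAt_pairing p))
  have hfun : (thirdAxis ∘ μ3 ∘ fun q : V3 × V3 => (q.2, q.1 ⬝ᵥ q.2)) =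
      fun p => ![0, 0, μ3 (p.2, p.1 ⬝ᵥ p.2)] := by
    funext q
    exact thirdAxis_apply _
  rw [hfun] at hμ
  rw [fderiv_Pim_apply hμ]
  simp only [ContinuousLinearMap.comp_apply, pairingDeriv_apply, thirdAxis_apply,
    fderiv_prodMk_eq]

theorem exists_dotProduct_eq {γ : V3} (hγ : γ ≠ 0) (s : ℝ) : ∃ M : V3, M ⬝ᵥ γ = s := by
  have hne : γ ⬝ᵥ γ ≠ 0 := by simpa using hγ
  exact ⟨(s / (γ ⬝ᵥ γ)) • γ, by rw [smul_dotProduct, smul_eq_mul, div_mul_cancel₀ _ hne]⟩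

set_option maxHeartbeats 1000000 in
theorem jacobiIdentity_thirdAxis_iff {μ3 : V3 × ℝ → ℝ} (h : Differentiable ℝ μ3) :
    JacobiIdentity (fun p => ![0, 0, μ3 (p.2, p.1 ⬝ᵥ p.2)]) ↔
      ∀ (γ : V3) (s : ℝ), γ 0 * gradg μ3 (γ, s) 1 - γ 1 * gradg μ3 (γ, s) 0 = 0 := by
  constructor
  · intro H γ s
    by_cases hγ : γ = 0
    · simp [hγ]
    obtain ⟨M, rfl⟩ := exists_dotProduct_eq hγ s
    have key := H (M, γ) (Sum.inl 0) (Sum.inl 1) (Sum.inl 2)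
    simp only [fderiv_Pim_thirdAxis_apply h] at key
    generalize μ3 (γ, M ⬝ᵥ γ) = m at key
    generalize gradg μ3 (γ, M ⬝ᵥ γ) = g at key ⊢
    generalize d4s μ3 (γ, M ⬝ᵥ γ) = d at key
    simp [Pim, dir, hat, Fin.sum_univ_three] at key
    linear_combination key
  · rintro H ⟨M, γ⟩ i j k
    have key := H γ (M ⬝ᵥ γ)
    simp only [fderiv_Pim_thirdAxis_apply h]
    simp only [Pim]
    generalize μ3 (γ, M ⬝ᵥ γ) = m
    generalize gradg μ3 (γ, M ⬝ᵥ γ) = g at key ⊢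
    generalize d4s μ3 (γ, M ⬝ᵥ γ) = d
    rcases i with i | i <;> rcases j with j | j <;> rcases k with k | k <;>
      fin_cases i <;> fin_cases j <;> fin_cases k <;>
      simp [dir, hat, Fin.sum_univ_three] <;>
      first
        | ring1
        | linear_combination key
        | linear_combination -key

theorem jacobiCondition_thirdAxis_eq (μ3 : V3 × ℝ → ℝ) (γ : V3) (s : ℝ) :
    γ ⬝ᵥ curlg (fun q => ![0, 0, μ3 q]) (γ, s) +
        (![0, 0, μ3 (γ, s)] : V3) ⬝ᵥ cross3 γ (d4 (fun q => ![0, 0, μ3 q]) (γ, s)) =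
      γ 0 * gradg μ3 (γ, s) 1 - γ 1 * gradg μ3 (γ, s) 0 := by
  simp [curlg, cross3, d4, gradg, dotProduct, Fin.sum_univ_three]
  ring

/-- For ν(γ,s) = (0,0,μ₃(γ,s)), the Jacobi condition equation holds iff
γ₁ ∂μ₃/∂γ₂ − γ₂ ∂μ₃/∂γ₁ = 0, and correspondingly for the Jacobi identity of Π_μ
with μ(M,γ) = (0,0,μ₃(γ,M·γ)). -/
theorem statement18 (μ3 : V3 × ℝ → ℝ) (h : ContDiff ℝ (⊤ : ℕ∞) μ3) :
    ((∀ (γ : V3) (s : ℝ),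
        γ ⬝ᵥ curlg (fun q => ![0, 0, μ3 q]) (γ, s) +
          (![0, 0, μ3 (γ, s)] : V3) ⬝ᵥ
            cross3 γ (d4 (fun q => ![0, 0, μ3 q]) (γ, s)) = 0) ↔
      (∀ (γ : V3) (s : ℝ),
        γ 0 * gradg μ3 (γ, s) 1 - γ 1 * gradg μ3 (γ, s) 0 = 0)) ∧
    (JacobiIdentity (fun p => ![0, 0, μ3 (p.2, p.1 ⬝ᵥ p.2)]) ↔
      (∀ (γ : V3) (s : ℝ),
        γ 0 * gradg μ3 (γ, s) 1 - γ 1 * gradg μ3 (γ, s) 0 = 0)) := by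
  simp only [jacobiCondition_thirdAxis_eq, true_and]
  exact jacobiIdentity_thirdAxis_iff (h.differentiable (by simp))
end
end
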